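/- Let Ω ⊆ ℝⁿ be a bounded open set and Λ > 0. If u and v are both continuous viscosity solutions of min{|∇w| − Λ e^{w}, −Δ_∞ w} = 0 in Ω with u = v = 0 on ∂Ω, and sup_{closure(Ω)} |u| < 1 and sup_{closure(Ω)} |v| < 1, then u = v on closure(Ω). -/

import Mathlib

open Real Set Metric Filter Topology

/-- `⟨D²φ(x)∇φ(x), ∇φ(x)⟩`, i.e. `Δ_∞φ(x)`. -/
noncomputable def hessQ {n : ℕ} (φ : EuclideanSpace ℝ (Fin n) → ℝ)
    (x : EuclideanSpace ℝ (Fin n)) : ℝ :=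
  iteratedFDeriv ℝ 2 φ x ![gradient φ x, gradient φ x]

/-- Viscosity supersolution of `min{|∇u| − Λ e^u, −Δ_∞ u} = 0` in `Ω`. -/
def IsInftySuper {n : ℕ} (Ω : Set (EuclideanSpace ℝ (Fin n))) (Λ : ℝ)
    (u : EuclideanSpace ℝ (Fin n) → ℝ) : Prop :=
  ∀ x₀ ∈ Ω, ∀ φ : EuclideanSpace ℝ (Fin n) → ℝ, ContDiff ℝ 2 φ →
    IsLocalMinOn (fun x => u x - φ x) Ω x₀ →
    (0 ≤ ‖gradient φ x₀‖ - Λ * Real.exp (u x₀) ∧ 0 ≤ -(hessQ φ x₀))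

/-- Viscosity subsolution of `min{|∇u| − Λ e^u, −Δ_∞ u} = 0` in `Ω`. -/
def IsInftySub {n : ℕ} (Ω : Set (EuclideanSpace ℝ (Fin n))) (Λ : ℝ)
    (u : EuclideanSpace ℝ (Fin n) → ℝ) : Prop :=
  ∀ x₀ ∈ Ω, ∀ φ : EuclideanSpace ℝ (Fin n) → ℝ, ContDiff ℝ 2 φ →
    IsLocalMaxOn (fun x => u x - φ x) Ω x₀ →
    min (‖gradient φ x₀‖ - Λ * Real.exp (u x₀)) (-(hessQ φ x₀)) ≤ 0

/-- Viscosity solution of `min{|∇u| − Λ e^u, −Δ_∞ u} = 0` in `Ω`. -/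
def IsInftySol {n : ℕ} (Ω : Set (EuclideanSpace ℝ (Fin n))) (Λ : ℝ)
    (u : EuclideanSpace ℝ (Fin n) → ℝ) : Prop :=
  IsInftySuper Ω Λ u ∧ IsInftySub Ω Λ u

theorem hasFDerivAt_comp_normSq {E : Type*} [NormedAddCommGroup E] [InnerProductSpace ℝ E]
    {H : ℝ → ℝ} {c : ℝ} {y x : E} (h : HasDerivAt H c (‖x - y‖ ^ 2)) :
    HasFDerivAt (fun z => H (‖z - y‖ ^ 2)) ((2 * c) • innerSL ℝ (x - y)) x := by
  have h1 : HasFDerivAt (fun z : E => ‖z - y‖ ^ 2) (2 • innerSL ℝ (x - y)) x := by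
    simpa using ((hasFDerivAt_id x).sub_const y).norm_sq
  refine (h.comp_hasFDerivAt x h1).congr_fderiv ?_
  ext z
  simp
  ring

theorem gradient_comp_normSq {n : ℕ} {H : ℝ → ℝ} {c : ℝ} {y x : EuclideanSpace ℝ (Fin n)}
    (h : HasDerivAt H c (‖x - y‖ ^ 2)) :
    gradient (fun z => H (‖z - y‖ ^ 2)) x = (2 * c) • (x - y) := by
  apply HasGradientAt.gradient
  rw [hasGradientAt_iff_hasFDerivAt]
  refine (hasFDerivAt_comp_normSq h).congr_fderiv ?_
  ext z
  simp

theorem hessQ_comp_normSq {n : ℕ} {H H' : ℝ → ℝ} {c : ℝ} {y x : EuclideanSpace ℝ (Fin n)}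
    (h : ∀ s, HasDerivAt H (H' s) s) (h' : HasDerivAt H' c (‖x - y‖ ^ 2)) :
    hessQ (fun z => H (‖z - y‖ ^ 2)) x =
      (2 * H' (‖x - y‖ ^ 2)) ^ 2 * ‖x - y‖ ^ 2 *
        (2 * H' (‖x - y‖ ^ 2) + 4 * c * ‖x - y‖ ^ 2) := by
  have h1 : fderiv ℝ (fun z => H (‖z - y‖ ^ 2)) =
      fun z => (2 * H' (‖z - y‖ ^ 2)) • innerSL ℝ (z - y) :=
    funext fun z => (hasFDerivAt_comp_normSq (h _)).fderiv
  have h2 : HasFDerivAt (fun z : EuclideanSpace ℝ (Fin n) => innerSL ℝ (z - y))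
      (innerSL ℝ) x := by
    exact (innerSL ℝ).hasFDerivAt.comp x ((hasFDerivAt_id x).sub_const y)
  have h3 := ((hasFDerivAt_comp_normSq h').const_mul 2).smul h2
  rw [hessQ, iteratedFDeriv_two_apply, gradient_comp_normSq (h _), h1]
  erw [h3.fderiv]
  generalize x - y = d
  have h4 : (innerSL ℝ d) d = ‖d‖ ^ 2 := real_inner_self_eq_norm_sq d
  simp only [Matrix.cons_val_zero, Matrix.cons_val_one, add_apply,
    smul_apply, ContinuousLinearMap.smulRight_apply, map_smul, smul_eq_mul,
    h4]
  ring

theorem exists_cone_profile {b η q : ℝ} (hb : 0 ≤ b) (hq : 0 < q) :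
    ∃ H H' : ℝ → ℝ, ContDiff ℝ 2 H ∧ (∀ s, HasDerivAt H (H' s) s) ∧
      H' (q ^ 2) = b / (2 * q) - η ∧ HasDerivAt H' (-b / (4 * q ^ 3)) (q ^ 2) ∧
      H (q ^ 2) = b * q - η * q ^ 2 ∧ ∀ ρ, 0 ≤ ρ → b * ρ - η * ρ ^ 2 ≤ H (ρ ^ 2) := by
  refine ⟨fun s => b * q * (1 + (s / q ^ 2 - 1) / 2 - (s / q ^ 2 - 1) ^ 2 / 8
      + (s / q ^ 2 - 1) ^ 3 / 16) - η * s,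
    fun s => b / q * (1 / 2 - (s / q ^ 2 - 1) / 4 + 3 * (s / q ^ 2 - 1) ^ 2 / 16) - η,
    by fun_prop, fun s => ?_, ?_, ?_, ?_, fun ρ hρ => ?_⟩
  · have h1 : HasDerivAt (fun s : ℝ => s / q ^ 2 - 1) (1 / q ^ 2) s :=
      ((hasDerivAt_id s).div_const _).sub_const _
    have h2 := ((((((h1.div_const 2).const_add 1).sub ((h1.pow 2).div_const 8)).add
      ((h1.pow 3).div_const 16)).const_mul (b * q)).sub ((hasDerivAt_id s).const_mul η))
    refine h2.congr_deriv ?_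
    norm_num
    field_simp
    ring
  · field_simp
    ring
  · have h1 : HasDerivAt (fun s : ℝ => s / q ^ 2 - 1) (1 / q ^ 2) (q ^ 2) :=
      ((hasDerivAt_id _).div_const _).sub_const _
    have h2 := ((((h1.div_const 4).const_sub (1 / 2)).add
      (((h1.pow 2).const_mul 3).div_const 16)).const_mul (b / q)).sub_const η
    refine h2.congr_deriv ?_
    field_simp
    norm_num
  · field_simp
    ring
  · obtain ⟨τ, rfl⟩ : ∃ τ, ρ = τ * q := ⟨ρ / q, by field_simp⟩
    have hτ : 0 ≤ τ := nonneg_of_mul_nonneg_left hρ hq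
    have h1 : (τ * q) ^ 2 / q ^ 2 = τ ^ 2 := by field_simp
    have h2 : 0 ≤ b * q * ((τ - 1) ^ 4 * (τ ^ 2 + 4 * τ + 5)) := by positivity
    simp only [h1]
    linarith

/-- The cone `b‖x - y‖ - η‖x - y‖²` is touched from above at any `x₀ ≠ y` by a smooth function with
the same gradient norm and infinity Laplacian at `x₀`. -/
theorem exists_cone_test {n : ℕ} {y x₀ : EuclideanSpace ℝ (Fin n)} {b η : ℝ} (hb : 0 ≤ b)
    (hx : x₀ ≠ y) :
    ∃ φ : EuclideanSpace ℝ (Fin n) → ℝ, ContDiff ℝ 2 φ ∧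
      φ x₀ = b * ‖x₀ - y‖ - η * ‖x₀ - y‖ ^ 2 ∧
      (∀ x, b * ‖x - y‖ - η * ‖x - y‖ ^ 2 ≤ φ x) ∧
      ‖gradient φ x₀‖ = |b - 2 * η * ‖x₀ - y‖| ∧
      hessQ φ x₀ = -(2 * η * (b - 2 * η * ‖x₀ - y‖) ^ 2) := by
  have hq : 0 < ‖x₀ - y‖ := norm_pos_iff.2 (sub_ne_zero.2 hx)
  obtain ⟨H, H', hH, hd, h1, h2, h3, h4⟩ := exists_cone_profile (η := η) hb hq
  refine ⟨fun x => H (‖x - y‖ ^ 2), ?_, h3, fun x => h4 _ (norm_nonneg _), ?_, ?_⟩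
  · exact hH.comp ((contDiff_id.sub contDiff_const).norm_sq ℝ)
  · rw [gradient_comp_normSq (hd _), h1, norm_smul, Real.norm_eq_abs,
      ← abs_of_pos hq, ← abs_mul, abs_of_pos hq]
    congr 1
    field_simp
  · rw [hessQ_comp_normSq hd h2, h1]
    field_simp
    ring

theorem gradient_neg_fun {n : ℕ} (φ : EuclideanSpace ℝ (Fin n) → ℝ)
    (x : EuclideanSpace ℝ (Fin n)) : gradient (fun z => -φ z) x = -gradient φ x := by
  simp [gradient, fderiv_fun_neg]

theorem hessQ_neg_fun {n : ℕ} (φ : EuclideanSpace ℝ (Fin n) → ℝ)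
    (x : EuclideanSpace ℝ (Fin n)) : hessQ (fun z => -φ z) x = -hessQ φ x := by
  have h : fderiv ℝ (fun z => -φ z) = fun z => -fderiv ℝ φ z := funext fun z => fderiv_fun_neg
  simp [hessQ, iteratedFDeriv_two_apply, gradient_neg_fun, h, fderiv_fun_neg]

section Cones

variable {n : ℕ} {Ω : Set (EuclideanSpace ℝ (Fin n))} {Λ : ℝ}
  {u : EuclideanSpace ℝ (Fin n) → ℝ} {y : EuclideanSpace ℝ (Fin n)} {R b : ℝ}

/-- Subsolutions enjoy comparison with steep cones from above. -/
theorem IsInftySub.le_cone (hu : IsInftySub Ω Λ u) (hc : Continuous u) (hR : 0 < R)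
    (hball : closedBall y R ⊆ Ω) (hb0 : 0 ≤ b)
    (hb : ∀ x ∈ closedBall y R, Λ * Real.exp (u x) ≤ b)
    (hs : ∀ x ∈ sphere y R, u x ≤ u y + b * R) {w : EuclideanSpace ℝ (Fin n)}
    (hw : w ∈ closedBall y R) : u w ≤ u y + b * ‖w - y‖ := by
  by_contra! hlt
  obtain ⟨η, hη0, hη⟩ : ∃ η > 0, 3 * η * R ^ 2 < u w - (u y + b * ‖w - y‖) := by
    refine ⟨(u w - (u y + b * ‖w - y‖)) / (4 * R ^ 2), by
      have := sub_pos.2 hlt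
      positivity, ?_⟩
    field_simp
    linarith
  have hηR : 0 < η * R := mul_pos hη0 hR
  obtain ⟨x₀, hx₀, hmax⟩ := (isCompact_closedBall y R).exists_isMaxOn
    (f := fun x => u x - ((b + 3 * η * R) * ‖x - y‖ - η * ‖x - y‖ ^ 2))
    ⟨w, hw⟩ (by fun_prop)
  have hmax' := isMaxOn_iff.1 hmax
  have hw' := mem_closedBall_iff_norm.1 hw
  have hbig : u y < u x₀ - ((b + 3 * η * R) * ‖x₀ - y‖ - η * ‖x₀ - y‖ ^ 2) := by
    refine lt_of_lt_of_le ?_ (hmax' w hw)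
    have : η * R * ‖w - y‖ ≤ η * R * R := by gcongr
    nlinarith [sq_nonneg ‖w - y‖]
  have hne : x₀ ≠ y := by
    rintro rfl
    simp at hbig
  have hlt' : ‖x₀ - y‖ < R := by
    refine lt_of_le_of_ne (mem_closedBall_iff_norm.1 hx₀) fun h => ?_
    have := hs x₀ (mem_sphere_iff_norm.2 h)
    rw [h] at hbig
    nlinarith
  obtain ⟨φ, hφ, h1, h2, h3, h4⟩ := exists_cone_test (η := η)
    (show 0 ≤ b + 3 * η * R by nlinarith) hne
  have key := hu x₀ (hball hx₀) φ hφ (by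
    have hmem : ball y R ∈ 𝓝 x₀ := isOpen_ball.mem_nhds (mem_ball_iff_norm.2 hlt')
    filter_upwards [mem_nhdsWithin_of_mem_nhds hmem] with x hx
    have := hmax' x (ball_subset_closedBall hx)
    have := h2 x
    linarith)
  have hg : b < b + 3 * η * R - 2 * η * ‖x₀ - y‖ := by nlinarith
  rw [h3, h4, abs_of_pos (hb0.trans_lt hg), neg_neg] at key
  have := hb x₀ hx₀
  have hpos := hb0.trans_lt hg
  rcases min_le_iff.1 key with h | h
  · linarith
  · have : 0 < 2 * η * (b + 3 * η * R - 2 * η * ‖x₀ - y‖) ^ 2 := by positivity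
    linarith

/-- Supersolutions enjoy comparison with cones from below. -/
theorem IsInftySuper.cone_le (hu : IsInftySuper Ω Λ u) (hc : Continuous u) (hR : 0 < R)
    (hball : closedBall y R ⊆ Ω) (hb0 : 0 ≤ b)
    (hs : ∀ x ∈ sphere y R, u y - b * R ≤ u x) {w : EuclideanSpace ℝ (Fin n)}
    (hw : w ∈ closedBall y R) : u y - b * ‖w - y‖ ≤ u w := by
  by_contra! hlt
  obtain ⟨η, hη0, hη⟩ : ∃ η > 0, 3 * η * R ^ 2 < u y - b * ‖w - y‖ - u w := by
    refine ⟨(u y - b * ‖w - y‖ - u w) / (4 * R ^ 2), by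
      have := sub_pos.2 hlt
      positivity, ?_⟩
    field_simp
    linarith
  have hηR : 0 < η * R := mul_pos hη0 hR
  obtain ⟨x₀, hx₀, hmin⟩ := (isCompact_closedBall y R).exists_isMinOn
    (f := fun x => u x + ((b + 3 * η * R) * ‖x - y‖ - η * ‖x - y‖ ^ 2))
    ⟨w, hw⟩ (by fun_prop)
  have hmin' := isMinOn_iff.1 hmin
  have hw' := mem_closedBall_iff_norm.1 hw
  have hbig : u x₀ + ((b + 3 * η * R) * ‖x₀ - y‖ - η * ‖x₀ - y‖ ^ 2) < u y := by
    refine (hmin' w hw).trans_lt ?_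
    have : η * R * ‖w - y‖ ≤ η * R * R := by gcongr
    nlinarith [sq_nonneg ‖w - y‖]
  have hne : x₀ ≠ y := by
    rintro rfl
    simp at hbig
  have hlt' : ‖x₀ - y‖ < R := by
    refine lt_of_le_of_ne (mem_closedBall_iff_norm.1 hx₀) fun h => ?_
    have := hs x₀ (mem_sphere_iff_norm.2 h)
    rw [h] at hbig
    nlinarith
  obtain ⟨φ, hφ, h1, h2, h3, h4⟩ := exists_cone_test (η := η)
    (show 0 ≤ b + 3 * η * R by nlinarith) hne
  have key := (hu x₀ (hball hx₀) (fun x => -φ x) hφ.neg (by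
    have hmem : ball y R ∈ 𝓝 x₀ := isOpen_ball.mem_nhds (mem_ball_iff_norm.2 hlt')
    filter_upwards [mem_nhdsWithin_of_mem_nhds hmem] with x hx
    have := hmin' x (ball_subset_closedBall hx)
    have := h2 x
    linarith)).2
  have hg : b < b + 3 * η * R - 2 * η * ‖x₀ - y‖ := by nlinarith
  have hpos := hb0.trans_lt hg
  rw [hessQ_neg_fun, h4, neg_neg] at key
  have : 0 < 2 * η * (b + 3 * η * R - 2 * η * ‖x₀ - y‖) ^ 2 := by positivity
  linarith

/-- The gradient constraint forces supersolutions to descend at a definite rate. -/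
theorem IsInftySuper.add_slope_le (hu : IsInftySuper Ω Λ u) (hc : Continuous u) (hΛ : 0 < Λ)
    (hR : 0 < R) (hball : closedBall y R ⊆ Ω) {m : ℝ} (hm : ∀ x ∈ closedBall y R, m ≤ u x) :
    m + R * (Λ * Real.exp m) ≤ u y := by
  by_contra! hlt
  set k := Λ * Real.exp m with hk
  have hk0 : 0 < k := by positivity
  obtain ⟨δ, hδ0, hδ⟩ : ∃ δ > 0, k * δ < m + R * k - u y := by
    refine ⟨(m + R * k - u y) / (2 * k), by
      have := sub_pos.2 hlt
      positivity, ?_⟩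
    field_simp
    linarith
  obtain ⟨x₀, hx₀, hmin⟩ := (isCompact_closedBall y R).exists_isMinOn
    (f := fun x => u x + k * √(‖x - y‖ ^ 2 + δ ^ 2))
    ⟨y, mem_closedBall_self hR.le⟩ (by fun_prop)
  have hmin' := isMinOn_iff.1 hmin
  have hq0 : 0 < ‖x₀ - y‖ ^ 2 + δ ^ 2 := by positivity
  have hlt' : ‖x₀ - y‖ < R := by
    refine lt_of_le_of_ne (mem_closedBall_iff_norm.1 hx₀) fun h => ?_
    have h1 := hmin' y (mem_closedBall_self hR.le)
    have h2 : R ≤ √(‖x₀ - y‖ ^ 2 + δ ^ 2) := Real.le_sqrt_of_sq_le (by rw [h]; nlinarith)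
    have h3 : k * R ≤ k * √(‖x₀ - y‖ ^ 2 + δ ^ 2) := by gcongr
    have h4 := hm x₀ hx₀
    simp [Real.sqrt_sq hδ0.le] at h1
    linarith
  set q := √(‖x₀ - y‖ ^ 2 + δ ^ 2) with hq
  have hqp : 0 < q := Real.sqrt_pos.2 hq0
  have hqsq : q ^ 2 = ‖x₀ - y‖ ^ 2 + δ ^ 2 := Real.sq_sqrt hq0.le
  have hd : ∀ s, HasDerivAt (fun s : ℝ => -(k * (s + δ ^ 2 + q ^ 2) / (2 * q)))
      (-(k / (2 * q))) s := fun s => by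
    have := (((((hasDerivAt_id s).add_const (δ ^ 2)).add_const (q ^ 2)).const_mul k).div_const
      (2 * q)).neg
    exact this.congr_deriv (by field_simp)
  have key := (hu x₀ (hball hx₀) (fun x => -(k * (‖x - y‖ ^ 2 + δ ^ 2 + q ^ 2) / (2 * q)))
    (by
      have : ContDiff ℝ 2 fun x : EuclideanSpace ℝ (Fin n) => ‖x - y‖ ^ 2 :=
        (contDiff_id.sub contDiff_const).norm_sq ℝ
      fun_prop)
    (by
      have hmem : ball y R ∈ 𝓝 x₀ := isOpen_ball.mem_nhds (mem_ball_iff_norm.2 hlt')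
      filter_upwards [mem_nhdsWithin_of_mem_nhds hmem] with x hx
      have h1 := hmin' x (ball_subset_closedBall hx)
      have h2 : k * √(‖x - y‖ ^ 2 + δ ^ 2) ≤ k * (‖x - y‖ ^ 2 + δ ^ 2 + q ^ 2) / (2 * q) := by
        rw [le_div_iff₀ (by positivity)]
        have h3 := Real.sq_sqrt (show 0 ≤ ‖x - y‖ ^ 2 + δ ^ 2 by positivity)
        have h4 := mul_nonneg hk0.le (sq_nonneg (√(‖x - y‖ ^ 2 + δ ^ 2) - q))
        nlinarith
      have h5 : k * (‖x₀ - y‖ ^ 2 + δ ^ 2 + q ^ 2) / (2 * q) = k * q := by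
        rw [← hqsq]
        field_simp
        ring
      linarith)).1
  rw [gradient_comp_normSq (hd _), norm_smul, Real.norm_eq_abs, mul_neg, abs_neg,
    abs_of_pos (by positivity)] at key
  have hρ : ‖x₀ - y‖ < q := Real.lt_sqrt_of_sq_lt (by nlinarith [pow_pos hδ0 2])
  have h6 : 2 * (k / (2 * q)) * ‖x₀ - y‖ < k := by
    rw [show 2 * (k / (2 * q)) * ‖x₀ - y‖ = k * ‖x₀ - y‖ / q by field_simp,
      div_lt_iff₀ hqp]
    gcongr
  have h7 : k ≤ Λ * Real.exp (u x₀) := by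
    rw [hk]
    gcongr
    exact hm x₀ hx₀
  linarith

end Cones

theorem exists_ball_max {n : ℕ} {u : EuclideanSpace ℝ (Fin n) → ℝ} (hu : Continuous u) {r : ℝ}
    (hr : 0 ≤ r) :
    ∃ U : EuclideanSpace ℝ (Fin n) → ℝ, Continuous U ∧ (∀ x, ∀ z ∈ closedBall x r, u z ≤ U x) ∧
      ∀ x, ∃ z ∈ closedBall x r, u z = U x := by
  have hK := isCompact_closedBall (0 : EuclideanSpace ℝ (Fin n)) r
  have hcont : ∀ x, Continuous fun z => u (x + z) := fun x => by fun_prop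
  refine ⟨fun x => sSup ((fun z => u (x + z)) '' closedBall 0 r),
    hK.continuous_sSup (f := fun x z => u (x + z))
      (hu.comp (continuous_fst.add continuous_snd)), fun x z hz => ?_, fun x => ?_⟩
  · refine le_csSup (hK.image (hcont x)).bddAbove ⟨z - x, ?_, by simp⟩
    simpa [← dist_eq_norm] using hz
  · obtain ⟨z, hz, h⟩ := (hK.image (hcont x)).sSup_mem
      ((nonempty_closedBall.2 hr).image _)
    exact ⟨x + z, by simpa [mem_closedBall_iff_norm] using hz, h⟩

theorem exists_ball_min {n : ℕ} {v : EuclideanSpace ℝ (Fin n) → ℝ} (hv : Continuous v) {r : ℝ}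
    (hr : 0 ≤ r) :
    ∃ V : EuclideanSpace ℝ (Fin n) → ℝ, Continuous V ∧ (∀ x, ∀ z ∈ closedBall x r, V x ≤ v z) ∧
      ∀ x, ∃ z ∈ closedBall x r, v z = V x := by
  obtain ⟨U, hU, h1, h2⟩ := exists_ball_max (u := fun x => -v x) hv.neg hr
  refine ⟨fun x => -U x, hU.neg, fun x z hz => neg_le.1 (h1 x z hz), fun x => ?_⟩
  obtain ⟨z, hz, h⟩ := h2 x
  exact ⟨z, hz, neg_eq_iff_eq_neg.1 h⟩

theorem exists_mem_closedBall_half {n : ℕ} {x z : EuclideanSpace ℝ (Fin n)} {r : ℝ}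
    (hz : z ∈ closedBall x (2 * r)) : ∃ p ∈ closedBall x r, z ∈ closedBall p r := by
  rw [mem_closedBall] at hz
  refine ⟨midpoint ℝ x z, ?_, ?_⟩
  · rw [mem_closedBall, dist_midpoint_left, dist_comm]
    norm_num
    linarith
  · rw [mem_closedBall, dist_comm, dist_midpoint_right, dist_comm]
    norm_num
    linarith

section Comparison

variable {n : ℕ} {Ω : Set (EuclideanSpace ℝ (Fin n))} {Λ : ℝ}
  {u v : EuclideanSpace ℝ (Fin n) → ℝ}

/-- At `x`, if the ball maximum of a subsolution rises steeply, then its increments are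
nondecreasing along the ball. -/
theorem IsInftySub.ball_max_le (hu : IsInftySub Ω Λ u) (hc : Continuous u) (hΛ : 0 < Λ)
    {x y : EuclideanSpace ℝ (Fin n)} {r M : ℝ} (hr : 0 < r) (hball : closedBall x (2 * r) ⊆ Ω)
    (hM : ∀ z ∈ closedBall x (2 * r), u z ≤ M) (hy : y ∈ closedBall x r) :
    u y - u x ≤ r * (Λ * Real.exp M) ∨ 2 * u y ≤ u x + M := by
  have hy' : y ∈ closedBall x (2 * r) := closedBall_subset_closedBall (by linarith) hy
  have hn := mem_closedBall_iff_norm.1 hy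
  have hb : 0 ≤ max (Λ * Real.exp M) ((M - u x) / (2 * r)) := le_max_of_le_left (by positivity)
  have key := hu.le_cone hc (by linarith : 0 < 2 * r) hball hb
    (fun z hz => le_max_of_le_left (by gcongr; exact hM z hz))
    (fun z hz => by
      have h1 := hM z (sphere_subset_closedBall hz)
      have h2 := le_max_right (Λ * Real.exp M) ((M - u x) / (2 * r))
      rw [div_le_iff₀ (by linarith)] at h2
      linarith) hy'
  have h3 := mul_le_mul_of_nonneg_left hn hb
  rcases max_choice (Λ * Real.exp M) ((M - u x) / (2 * r)) with h | h
  · left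
    rw [h] at key h3
    linarith
  · right
    rw [h] at key h3
    have : (M - u x) / (2 * r) * r = (M - u x) / 2 := by field_simp
    linarith

theorem IsInftySuper.le_ball_min (hv : IsInftySuper Ω Λ v) (hc : Continuous v)
    {x y : EuclideanSpace ℝ (Fin n)} {r m : ℝ} (hr : 0 < r) (hball : closedBall x (2 * r) ⊆ Ω)
    (hm : ∀ z ∈ closedBall x (2 * r), m ≤ v z) (hy : y ∈ closedBall x r) :
    v x + m ≤ 2 * v y := by
  have hy' : y ∈ closedBall x (2 * r) := closedBall_subset_closedBall (by linarith) hy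
  have hn := mem_closedBall_iff_norm.1 hy
  have hx := hm x (mem_closedBall_self (by linarith))
  have hb : 0 ≤ (v x - m) / (2 * r) := div_nonneg (by linarith) (by linarith)
  have key := hv.cone_le hc (by linarith : 0 < 2 * r) hball hb
    (fun z hz => by
      have h1 := hm z (sphere_subset_closedBall hz)
      have h2 : (v x - m) / (2 * r) * (2 * r) = v x - m := by field_simp
      linarith) hy'
  have h3 := mul_le_mul_of_nonneg_left hn hb
  have : (v x - m) / (2 * r) * r = (v x - m) / 2 := by field_simp
  linarith

theorem IsInftySuper.nonneg (hv : IsInftySuper Ω Λ v) (hΩb : Bornology.IsBounded Ω) (hΛ : 0 < Λ)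
    (hc : Continuous v) (h0 : ∀ x ∉ Ω, v x = 0) (x : EuclideanSpace ℝ (Fin n)) : 0 ≤ v x := by
  by_contra! hx
  have hxΩ : x ∈ Ω := by
    by_contra h
    exact hx.ne (h0 x h)
  obtain ⟨z, -, hmin⟩ := hΩb.isCompact_closure.exists_isMinOn ⟨x, subset_closure hxΩ⟩
    hc.continuousOn
  have hz := isMinOn_iff.1 hmin
  have hzΩ : z ∈ Ω := by
    by_contra h
    linarith [hz x (subset_closure hxΩ), h0 z h]
  have key := (hv z hzΩ (fun _ => 0) contDiff_const (by
    filter_upwards [self_mem_nhdsWithin] with y hy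
    simpa using hz y (subset_closure hy))).1
  have : 0 < Λ * Real.exp (v z) := by positivity
  simp [gradient] at key
  linarith

/-- Comparison principle for subsolutions bounded by a constant smaller than `1`. -/
theorem IsInftySub.le_super (hu : IsInftySub Ω Λ u) (hv : IsInftySuper Ω Λ v)
    (hΩb : Bornology.IsBounded Ω) (hΛ : 0 < Λ) (huc : Continuous u) (hvc : Continuous v)
    (hu0 : ∀ x ∉ Ω, u x = 0) (hv0 : ∀ x ∉ Ω, v x = 0) {m : ℝ} (hm : m < 1)
    (hum : ∀ x, u x ≤ m) (x₁ : EuclideanSpace ℝ (Fin n)) : u x₁ ≤ v x₁ := by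
  by_contra! hlt
  have hvnn := hv.nonneg hΩb hΛ hvc hv0
  have hv1 := hvnn x₁
  have hx₁ : x₁ ∈ Ω := by
    by_contra h
    linarith [hu0 x₁ h, hv0 x₁ h]
  -- Lower bound for the ratio `u / (v + ε)`, uniform in `ε ≤ (u x₁ - v x₁) / 2`.
  set t₀ := u x₁ / (v x₁ + (u x₁ - v x₁) / 2) with ht₀
  have ht₀1 : 1 < t₀ := by
    rw [ht₀, one_lt_div (by linarith)]
    linarith
  have hgap : 0 < (1 - m) * (1 - t₀⁻¹) :=
    mul_pos (by linarith) (sub_pos.2 (inv_lt_one_of_one_lt₀ ht₀1))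
  obtain ⟨ε, hε0, hε1, hε2⟩ : ∃ ε > 0, ε ≤ (u x₁ - v x₁) / 2 ∧
      3 * ε < (1 - m) * (1 - t₀⁻¹) := by
    refine ⟨min ((u x₁ - v x₁) / 2) ((1 - m) * (1 - t₀⁻¹) / 4),
      lt_min (by linarith) (by linarith), min_le_left _ _, ?_⟩
    linarith [min_le_right ((u x₁ - v x₁) / 2) ((1 - m) * (1 - t₀⁻¹) / 4)]
  -- A radius on which both functions oscillate by less than `ε`.
  have hunif : ∀ w : EuclideanSpace ℝ (Fin n) → ℝ, Continuous w → (∀ x ∉ Ω, w x = 0) →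
      ∃ d > 0, ∀ a b, dist a b < d → |w a - w b| < ε := fun w hw hw0 => by
    have hcs : HasCompactSupport w :=
      HasCompactSupport.intro hΩb.isCompact_closure fun x hx =>
        hw0 x fun h => hx (subset_closure h)
    obtain ⟨d, hd, h⟩ := Metric.uniformContinuous_iff.1
      (hcs.uniformContinuous_of_continuous hw) ε hε0
    exact ⟨d, hd, fun a b hab => h hab⟩
  obtain ⟨d₁, hd₁, hosc_u⟩ := hunif u huc hu0
  obtain ⟨d₂, hd₂, hosc_v⟩ := hunif v hvc hv0
  obtain ⟨r, hr, hr1, hr2⟩ : ∃ r > 0, 3 * r < d₁ ∧ 3 * r < d₂ := by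
    refine ⟨min d₁ d₂ / 4, by positivity, ?_, ?_⟩
    · linarith [min_le_left d₁ d₂, lt_min hd₁ hd₂]
    · linarith [min_le_right d₁ d₂, lt_min hd₁ hd₂]
  obtain ⟨U, hUc, hU1, hU2⟩ := exists_ball_max huc hr.le
  obtain ⟨V, hVc, hV1, hV2⟩ := exists_ball_min hvc hr.le
  have hVnn : ∀ x, 0 ≤ V x := fun x => by
    obtain ⟨z, -, hz⟩ := hV2 x
    exact hz ▸ hvnn z
  have hVε : ∀ x, 0 < V x + ε := fun x => by linarith [hVnn x]
  have hρc : Continuous fun x => U x / (V x + ε) :=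
    hUc.div (hVc.add continuous_const) fun x => (hVε x).ne'
  have hcpt := hΩb.isCompact_closure
  obtain ⟨xs, hxs, hmax⟩ := hcpt.exists_isMaxOn ⟨x₁, subset_closure hx₁⟩ hρc.continuousOn
  set t := U xs / (V xs + ε) with ht
  have htt₀ : t₀ ≤ t := by
    refine le_trans ?_ (isMaxOn_iff.1 hmax x₁ (subset_closure hx₁))
    have h1 := hU1 x₁ x₁ (mem_closedBall_self hr.le)
    have h2 := hV1 x₁ x₁ (mem_closedBall_self hr.le)
    have h3 := hVε x₁
    rw [ht₀]
    gcongr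
    linarith
  have ht1 : 1 < t := ht₀1.trans_le htt₀
  have hfar : ∀ x, ¬ closedBall x (2 * r) ⊆ Ω → U x < V x + ε := fun x hx => by
    obtain ⟨p, hp, hpΩ⟩ := not_subset.1 hx
    obtain ⟨z, hz, hzU⟩ := hU2 x
    rw [mem_closedBall] at hp hz
    have h1 := hosc_u z p (by
      have := dist_triangle_right z p x
      linarith)
    rw [hu0 p hpΩ, abs_lt] at h1
    linarith [hVnn x]
  have hle : ∀ x, U x ≤ t * (V x + ε) := fun x => by
    by_cases hx : x ∈ closure Ω
    · exact (div_le_iff₀ (hVε x)).1 (isMaxOn_iff.1 hmax x hx)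
    · have h1 := hfar x fun h => hx (subset_closure (h (mem_closedBall_self (by linarith))))
      have h2 := hVε x
      nlinarith
  have hnear : ∀ x, U x = t * (V x + ε) → closedBall x (2 * r) ⊆ Ω := fun x hx => by
    by_contra h
    have h1 := hfar x h
    have h2 := hVε x
    nlinarith
  -- Among the maximum points of the ratio, take one where `U` is largest.
  have hEc : IsCompact (closure Ω ∩ {x | U x = t * (V x + ε)}) :=
    hcpt.inter_right (isClosed_eq hUc (by fun_prop))
  obtain ⟨x, ⟨-, hxE⟩, hxmax⟩ := hEc.exists_isMaxOn
    ⟨xs, hxs, by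
      have := hVε xs
      simp only [mem_ofPred_eq, ht]
      field_simp⟩ hUc.continuousOn
  simp only [mem_ofPred_eq] at hxE
  have hball := hnear x hxE
  have h2r : (closedBall x (2 * r)).Nonempty := nonempty_closedBall.2 (by linarith)
  have hsub : ∀ p ∈ closedBall x r, closedBall p r ⊆ closedBall x (2 * r) := fun p hp =>
    closedBall_subset_closedBall' (by rw [mem_closedBall] at hp; linarith)
  obtain ⟨z, hz, hzmax⟩ := (isCompact_closedBall x (2 * r)).exists_isMaxOn h2r huc.continuousOn
  obtain ⟨z', hz', hzmin⟩ := (isCompact_closedBall x (2 * r)).exists_isMinOn h2r hvc.continuousOn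
  rw [isMaxOn_iff] at hzmax
  rw [isMinOn_iff] at hzmin
  obtain ⟨p, hp, hzp⟩ := exists_mem_closedBall_half hz
  obtain ⟨p', hp', hzp'⟩ := exists_mem_closedBall_half hz'
  obtain ⟨y, hy, hyU⟩ := hU2 x
  obtain ⟨y', hy', hyV⟩ := hV2 x
  have hzU : u z ≤ U p := hU1 p z hzp
  have hVz : V p' ≤ v z' := hV1 p' z' hzp'
  have hxU : u x ≤ U p' := hU1 p' x (by rwa [mem_closedBall_comm])
  have hVx : V p ≤ v x := hV1 p x (by rwa [mem_closedBall_comm])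
  have hux : u x ≤ t * (v z' + ε) := by
    have := hle p'
    nlinarith
  have huz : u z ≤ t * (v x + ε) := by
    have := hle p
    nlinarith
  have hVdouble := hv.le_ball_min hvc hr hball hzmin hy'
  have hslope := hv.add_slope_le (y := y') hvc hΛ hr ((hsub y' hy').trans hball)
    (fun w hw => hzmin w (hsub y' hy' hw))
  rw [hyV] at hVdouble hslope
  have hslope0 : 0 < r * (Λ * Real.exp (v z')) := by positivity
  have hsteep : t * (r * (Λ * Real.exp (v z'))) ≤ U x - u x := by nlinarith
  rcases hu.ball_max_le huc hΛ hr hball hzmax hy with h | h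
  · rw [hyU] at h
    have h1 : t * Real.exp (v z') ≤ Real.exp (u z) := by
      have h2 : r * Λ * (t * Real.exp (v z')) ≤ r * Λ * Real.exp (u z) := by linarith
      exact le_of_mul_le_mul_left h2 (by positivity)
    have ht0 : 0 < t := by linarith
    have h3 : Real.log t ≤ u z - v z' := by
      have h4 := Real.log_le_log (by positivity) h1
      rw [Real.log_mul ht0.ne' (Real.exp_pos _).ne', Real.log_exp, Real.log_exp] at h4
      linarith
    have h5 := Real.one_sub_inv_le_log_of_pos ht0
    rw [mem_closedBall] at hz hz' hy hy'
    have h6 := (abs_lt.1 (hosc_u z y (by linarith [dist_triangle_right z y x]))).2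
    have h7 := (abs_lt.1 (hosc_v y' z' (by linarith [dist_triangle_right y' z' x]))).2
    have h8 : V x + ε = U x * t⁻¹ := by
      rw [hxE]
      field_simp
    have h9 : t⁻¹ ≤ t₀⁻¹ := inv_anti₀ (by linarith) htt₀
    have h10 : t₀⁻¹ < 1 := inv_lt_one_of_one_lt₀ ht₀1
    have h11 : U x * (1 - t⁻¹) ≤ m * (1 - t⁻¹) :=
      mul_le_mul_of_nonneg_right (hyU ▸ hum y) (by linarith)
    have h12 : (1 - m) * (1 - t₀⁻¹) ≤ (1 - m) * (1 - t⁻¹) :=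
      mul_le_mul_of_nonneg_left (by linarith) (by linarith)
    linarith
  · rw [hyU] at h
    have hpE : U p = t * (V p + ε) := by
      refine le_antisymm (hle p) ?_
      nlinarith
    have hpΩ : p ∈ closure Ω :=
      subset_closure (hnear p hpE (mem_closedBall_self (by linarith)))
    have := isMaxOn_iff.1 hxmax p ⟨hpΩ, hpE⟩
    nlinarith

end Comparison

theorem IsInftySuper.congr {n : ℕ} {Ω : Set (EuclideanSpace ℝ (Fin n))} {Λ : ℝ}
    {u w : EuclideanSpace ℝ (Fin n) → ℝ} (hu : IsInftySuper Ω Λ u) (h : EqOn u w Ω) :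
    IsInftySuper Ω Λ w := fun x hx φ hφ hmin => by
  rw [← h hx]
  refine hu x hx φ hφ (hmin.congr ?_ hx)
  filter_upwards [self_mem_nhdsWithin] with y hy
  rw [h hy]

theorem IsInftySub.congr {n : ℕ} {Ω : Set (EuclideanSpace ℝ (Fin n))} {Λ : ℝ}
    {u w : EuclideanSpace ℝ (Fin n) → ℝ} (hu : IsInftySub Ω Λ u) (h : EqOn u w Ω) :
    IsInftySub Ω Λ w := fun x hx φ hφ hmax => by
  rw [← h hx]
  refine hu x hx φ hφ (hmax.congr ?_ hx)
  filter_upwards [self_mem_nhdsWithin] with y hy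
  rw [h hy]

/-- Comparison on a bounded open set, for functions continuous up to the boundary. -/
theorem IsInftySub.le_super_of_continuousOn {n : ℕ} {Ω : Set (EuclideanSpace ℝ (Fin n))} {Λ : ℝ}
    {u v : EuclideanSpace ℝ (Fin n) → ℝ} (hu : IsInftySub Ω Λ u) (hv : IsInftySuper Ω Λ v)
    (hΩb : Bornology.IsBounded Ω) (hΛ : 0 < Λ)
    (huc : ContinuousOn u (closure Ω)) (hvc : ContinuousOn v (closure Ω))
    (hu0 : ∀ x ∈ frontier Ω, u x = 0) (hv0 : ∀ x ∈ frontier Ω, v x = 0)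
    (hus : sSup ((fun x => |u x|) '' closure Ω) < 1) {x : EuclideanSpace ℝ (Fin n)}
    (hx : x ∈ Ω) : u x ≤ v x := by
  have hnn : 0 ≤ sSup ((fun x => |u x|) '' closure Ω) :=
    Real.sSup_nonneg (by rintro _ ⟨y, -, rfl⟩; exact abs_nonneg _)
  have key := (hu.congr (w := Ω.indicator u) fun y hy => (indicator_of_mem hy u).symm).le_super
    (hv.congr (w := Ω.indicator v) fun y hy => (indicator_of_mem hy v).symm) hΩb hΛ
    (continuous_indicator hu0 huc) (continuous_indicator hv0 hvc)
    (fun y hy => indicator_of_notMem hy u) (fun y hy => indicator_of_notMem hy v) hus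
    (fun y => by
      by_cases hy : y ∈ Ω
      · rw [indicator_of_mem hy]
        exact (le_abs_self _).trans (le_csSup (hΩb.isCompact_closure.image_of_continuousOn
          huc.abs).bddAbove ⟨y, subset_closure hy, rfl⟩)
      · rwa [indicator_of_notMem hy]) x
  rwa [indicator_of_mem hx, indicator_of_mem hx] at key

/-- Uniqueness of solutions of the limit problem with sup-norm
strictly below `1`. -/
theorem uniqueness_small_solutions {n : ℕ} (Ω : Set (EuclideanSpace ℝ (Fin n)))
    (hΩo : IsOpen Ω) (hΩb : Bornology.IsBounded Ω)
    (Λ : ℝ) (hΛ : 0 < Λ)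
    (u v : EuclideanSpace ℝ (Fin n) → ℝ)
    (hu_cont : ContinuousOn u (closure Ω)) (hv_cont : ContinuousOn v (closure Ω))
    (hu_sol : IsInftySol Ω Λ u) (hv_sol : IsInftySol Ω Λ v)
    (hu_bdry : ∀ x ∈ frontier Ω, u x = 0) (hv_bdry : ∀ x ∈ frontier Ω, v x = 0)
    (hu_small : sSup ((fun x => |u x|) '' closure Ω) < 1)
    (hv_small : sSup ((fun x => |v x|) '' closure Ω) < 1) :
    Set.EqOn u v (closure Ω) := by
  intro x hx
  by_cases hxΩ : x ∈ Ω
  · exact le_antisymm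
      (hu_sol.2.le_super_of_continuousOn hv_sol.1 hΩb hΛ hu_cont hv_cont hu_bdry hv_bdry
        hu_small hxΩ)
      (hv_sol.2.le_super_of_continuousOn hu_sol.1 hΩb hΛ hv_cont hu_cont hv_bdry hu_bdry
        hv_small hxΩ)
  · have hf : x ∈ frontier Ω := ⟨hx, fun h => hxΩ (interior_subset h)⟩
    rw [hu_bdry x hf, hv_bdry x hf]
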